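/- arXiv:1607.06177 — 2 statements merged into one kernel-verified Lean document; each statement's English description precedes it below -/
import Mathlib

section
/- Let Ω ⊆ 𝒰 be a connected open set, let (A_k) be a null sequence of diffusion matrices on 𝒰, and suppose there is a uniform Lyapunov function U on Ω with respect to (ℒ_{A_k}), with essential lower bound ρ_m. For each k let μ_k be a Borel probability measure on Ω that is a stationary measure for ℒ_{A_k} on Ω, and suppose μ_k → μ weak* for some Borel probability measure μ on Ω. Then the support of μ is contained in the compact set {x ∈ Ω : U(x) ≤ ρ_m}. -/
open MeasureTheory Set Filter Topology

noncomputable section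

/-- Euclidean `n`-space. -/
abbrev En (n : ℕ) := EuclideanSpace ℝ (Fin n)

/-- The adjoint Fokker–Planck operator
`ℒ_A f(x) = ∑ᵢⱼ aⁱʲ(x) ∂²f/∂xᵢ∂xⱼ(x) + ∑ᵢ Vⁱ(x) ∂f/∂xᵢ(x)`. -/
noncomputable def adjFP {n : ℕ} (A : En n → Matrix (Fin n) (Fin n) ℝ) (V : En n → En n)
    (f : En n → ℝ) (x : En n) : ℝ :=
  (∑ i, ∑ j, A x i j *
      iteratedFDeriv ℝ 2 f x ![EuclideanSpace.single i (1 : ℝ), EuclideanSpace.single j (1 : ℝ)])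
    + fderiv ℝ f x (V x)
/-- A Borel probability measure concentrated on `Ω`. -/
def IsProbOn {n : ℕ} (Ω : Set (En n)) (μ : Measure (En n)) : Prop :=
  IsProbabilityMeasure μ ∧ μ Ωᶜ = 0
/-- `μ` is a stationary measure for `ℒ_A` on `Ω`: it is a Borel probability measure on `Ω`
and `∫_Ω ℒ_A f dμ = 0` for every smooth `f` with compact support contained in `Ω`. -/
def IsStationaryMeasure {n : ℕ} (A : En n → Matrix (Fin n) (Fin n) ℝ) (V : En n → En n)
    (Ω : Set (En n)) (μ : Measure (En n)) : Prop :=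
  IsProbOn Ω μ ∧
  ∀ f : En n → ℝ, ContDiff ℝ (⊤ : ℕ∞) f → HasCompactSupport f → tsupport f ⊆ Ω →
    ∫ x in Ω, adjFP A V f x ∂μ = 0
/-- A null sequence of diffusion matrices on `𝒰`: continuous maps into the symmetric
positive-definite matrices converging to `0` uniformly on every compact subset of `𝒰`. -/
def IsNullSeq {n : ℕ} (𝒰 : Set (En n)) (A : ℕ → En n → Matrix (Fin n) (Fin n) ℝ) : Prop :=
  (∀ k, ContinuousOn (A k) 𝒰) ∧
  (∀ k, ∀ x ∈ 𝒰, (A k x).PosDef) ∧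
  (∀ K : Set (En n), K ⊆ 𝒰 → IsCompact K →
    ∀ ε > 0, ∃ N, ∀ k ≥ N, ∀ x ∈ K, ∀ i j, |A k x i j| ≤ ε)
/-- Weak* convergence `μs → μ` of Borel probability measures on `Ω`: the integrals of every
bounded continuous function on `Ω` converge. -/
def WeakStarLimOn {n : ℕ} (Ω : Set (En n)) (μs : ℕ → Measure (En n))
    (μ : Measure (En n)) : Prop :=
  ∀ f : En n → ℝ, ContinuousOn f Ω → (∃ C, ∀ x ∈ Ω, |f x| ≤ C) →
    Tendsto (fun k => ∫ x in Ω, f x ∂μs k) atTop (𝓝 (∫ x in Ω, f x ∂μ))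
/-- The support of a Borel measure: points all of whose open neighborhoods have
positive measure. -/
def measSupp {n : ℕ} (μ : Measure (En n)) : Set (En n) :=
  {x | ∀ s : Set (En n), IsOpen s → x ∈ s → 0 < μ s}
/-- A compact function on `Ω`: a continuous nonnegative function `U` with
`U x < ρ_M := sup_Ω U` everywhere and compact sublevel sets `{x ∈ Ω | U x ≤ ρ}`
for every `ρ < ρ_M` (the supremum is taken in `EReal`, allowing `ρ_M = ∞`). -/
def IsCompactFunctionOn {n : ℕ} (U : En n → ℝ) (Ω : Set (En n)) : Prop :=
  ContinuousOn U Ω ∧ (∀ x ∈ Ω, 0 ≤ U x) ∧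
  (∀ x ∈ Ω, (U x : EReal) < ⨆ y ∈ Ω, (U y : EReal)) ∧
  (∀ ρ : ℝ, (ρ : EReal) < ⨆ y ∈ Ω, (U y : EReal) → IsCompact {x ∈ Ω | U x ≤ ρ})
/-- `U` is a uniform Lyapunov function on `Ω` with respect to `(ℒ_{A_k})`, with essential lower
bound `ρ_m` and constant `γ`: `U` is a `C²` compact function on `Ω` with `ρ_m ∈ (0, ρ_M)`,
`γ > 0`, and `ℒ_{A_k}U(x) ≤ −γ` for every `k` and every `x ∈ Ω` with `U(x) > ρ_m`. -/
def IsUniformLyap {n : ℕ} (A : ℕ → En n → Matrix (Fin n) (Fin n) ℝ) (V : En n → En n)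
    (Ω : Set (En n)) (U : En n → ℝ) (ρm γ : ℝ) : Prop :=
  ContDiffOn ℝ 2 U Ω ∧ IsCompactFunctionOn U Ω ∧
  0 < ρm ∧ ((ρm : EReal) < ⨆ y ∈ Ω, (U y : EReal)) ∧ 0 < γ ∧
  ∀ k, ∀ x ∈ Ω, ρm < U x → adjFP (A k) V U x ≤ -γ

lemma aux_bdd {n : ℕ} {Ω K : Set (En n)} {g : En n → ℝ} (hg : ContinuousOn g Ω)
    (hK : IsCompact K) (hKΩ : K ⊆ Ω) (h0 : ∀ x, x ∉ K → g x = 0) :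
    ∃ C, ∀ x ∈ Ω, |g x| ≤ C := by
  obtain ⟨C, hC⟩ := hK.exists_bound_of_continuousOn (hg.mono hKΩ)
  refine ⟨max C 0, fun x _ => ?_⟩
  by_cases hx : x ∈ K
  · exact (hC x hx).trans (le_max_left _ _)
  · rw [h0 x hx]; simp

lemma aux_int {n : ℕ} {Ω : Set (En n)} {g : En n → ℝ} (hg : ContinuousOn g Ω)
    (hΩ : IsOpen Ω) (hb : ∃ C, ∀ x ∈ Ω, |g x| ≤ C) (μ : Measure (En n)) [IsFiniteMeasure μ] :
    IntegrableOn g Ω μ := by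
  obtain ⟨C, hC⟩ := hb
  exact IntegrableOn.of_bound (measure_lt_top _ _)
    (hg.aestronglyMeasurable hΩ.measurableSet) C
    ((ae_restrict_iff' hΩ.measurableSet).2 (Eventually.of_forall hC))

lemma aux_fderiv0 {n : ℕ} {K : Set (En n)} {f : En n → ℝ} (hf : tsupport f ⊆ K)
    (x : En n) (hx : x ∉ K) : fderiv ℝ f x = 0 := by
  have : x ∉ tsupport (fderiv ℝ f) := fun h => hx (hf (tsupport_fderiv_subset ℝ h))
  exact image_eq_zero_of_notMem_tsupport this

/-- The limit measure is invariant when tested on smooth functions. -/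
lemma aux_smooth {n : ℕ} (𝒰 Ω : Set (En n))
    (V : En n → En n) (hV : ContinuousOn V 𝒰)
    (hΩopen : IsOpen Ω) (hΩ𝒰 : Ω ⊆ 𝒰)
    (A : ℕ → En n → Matrix (Fin n) (Fin n) ℝ) (hA : IsNullSeq 𝒰 A)
    (μs : ℕ → Measure (En n)) (hμs : ∀ k, IsStationaryMeasure (A k) V Ω (μs k))
    (μ : Measure (En n)) (hlim : WeakStarLimOn Ω μs μ)
    (f : En n → ℝ) (hf : ContDiff ℝ (⊤ : ℕ∞) f) (hfc : HasCompactSupport f)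
    (hfΩ : tsupport f ⊆ Ω) : ∫ x in Ω, fderiv ℝ f x (V x) ∂μ = 0 := by
  have hD : ContinuousOn (fun x => fderiv ℝ f x (V x)) Ω :=
    ((hf.continuous_fderiv (by simp)).continuousOn).clm_apply (hV.mono hΩ𝒰)
  have hDb := aux_bdd hD hfc hfΩ (fun x hx => by
    rw [aux_fderiv0 (subset_refl _) x hx]; rfl)
  have h1 := hlim _ hD hDb
  refine tendsto_nhds_unique h1 ?_
  -- second derivative term
  set H : Fin n → Fin n → En n → ℝ := fun i j x =>
    iteratedFDeriv ℝ 2 f x ![EuclideanSpace.single i (1 : ℝ), EuclideanSpace.single j (1 : ℝ)]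
    with hH
  have hHc : ∀ i j, Continuous (H i j) := by
    intro i j
    have h2 : Continuous (iteratedFDeriv ℝ 2 f) :=
      (hf.of_le (m := ((2 : ℕ∞) : WithTop ℕ∞))
        (WithTop.coe_le_coe.2 le_top)).continuous_iteratedFDeriv (le_refl _)
    exact (ContinuousMultilinearMap.apply ℝ (fun _ : Fin 2 => En n) ℝ ![EuclideanSpace.single i (1 : ℝ),
      EuclideanSpace.single j (1 : ℝ)]).continuous.comp h2
  have hH0 : ∀ i j x, x ∉ tsupport f → H i j x = 0 := by
    intro i j x hx
    have : x ∉ tsupport (iteratedFDeriv ℝ 2 f) :=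
      fun h => hx (tsupport_iteratedFDeriv_subset 2 h)
    simp [hH, image_eq_zero_of_notMem_tsupport this]
  have hHb : ∃ C, 0 ≤ C ∧ ∀ i j x, |H i j x| ≤ C := by
    have : ∀ i j, ∃ C, ∀ x ∈ (univ : Set (En n)), |H i j x| ≤ C := fun i j =>
      aux_bdd (hHc i j).continuousOn hfc (subset_univ _) (hH0 i j)
    choose C hC using this
    refine ⟨∑ i, ∑ j, |C i j|, by positivity, fun i j x => ?_⟩
    calc |H i j x| ≤ |C i j| := (hC i j x (mem_univ _)).trans (le_abs_self _)
      _ ≤ ∑ j, |C i j| := Finset.single_le_sum (f := fun j => |C i j|)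
          (fun _ _ => abs_nonneg _) (Finset.mem_univ j)
      _ ≤ _ := Finset.single_le_sum (f := fun i => ∑ j, |C i j|)
          (fun _ _ => by positivity) (Finset.mem_univ i)
  obtain ⟨C, hC0, hC⟩ := hHb
  set S : ℕ → En n → ℝ := fun k x => ∑ i, ∑ j, A k x i j * H i j x with hS
  have hSc : ∀ k, ContinuousOn (S k) Ω := by
    intro k
    have hAk := (hA.1 k).mono hΩ𝒰
    refine continuousOn_finsetSum _ fun i _ => continuousOn_finsetSum _ fun j _ => ?_
    refine ContinuousOn.mul ?_ (hHc i j).continuousOn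
    exact (continuous_id.matrix_elem i j).comp_continuousOn hAk
  have hSb : ∀ k, ∃ C, ∀ x ∈ Ω, |S k x| ≤ C := fun k =>
    aux_bdd (hSc k) hfc hfΩ (fun x hx => by simp [hS, hH0 _ _ x hx])
  have key : ∀ k, ∫ x in Ω, fderiv ℝ f x (V x) ∂μs k = - ∫ x in Ω, S k x ∂μs k := by
    intro k
    haveI := (hμs k).1.1
    have h := (hμs k).2 f hf hfc hfΩ
    have e : (fun x => adjFP (A k) V f x) = fun x => S k x + fderiv ℝ f x (V x) := rfl
    rw [e, integral_add (aux_int (hSc k) hΩopen (hSb k) _) (aux_int hD hΩopen hDb _)] at h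
    linarith
  rw [Metric.tendsto_atTop]
  intro ε hε
  obtain ⟨N, hN⟩ := hA.2.2 (tsupport f) (hfΩ.trans hΩ𝒰) hfc (ε / (2 * (n * (n * (C + 1)) + 1)))
    (by positivity)
  refine ⟨N, fun k hk => ?_⟩
  haveI := (hμs k).1.1
  rw [key, dist_zero_right, norm_neg]
  set η := ε / (2 * (n * (n * (C + 1)) + 1)) with hη
  have hη0 : 0 < η := by positivity
  have hb : ∀ x ∈ Ω, ‖S k x‖ ≤ n * (n * (η * C)) := by
    intro x _
    by_cases hx : x ∈ tsupport f
    · calc ‖S k x‖ ≤ ∑ i : Fin n, ∑ j : Fin n, η * C := by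
            refine norm_sum_le_of_le _ fun i _ => norm_sum_le_of_le _ fun j _ => ?_
            rw [norm_mul]
            exact mul_le_mul (hN k hk x hx i j) (hC i j x) (norm_nonneg _) hη0.le
        _ = _ := by simp
    · have : S k x = 0 := by simp [hS, hH0 _ _ x hx]
      rw [this, norm_zero]; positivity
  have h3 := norm_setIntegral_le_of_norm_le_const (measure_lt_top (μs k) Ω) hb
  have h4 : (μs k).real Ω ≤ 1 := measureReal_le_one
  have h5 : η * (2 * (n * (n * (C + 1)) + 1)) = ε := by
    rw [hη]; field_simp
  calc _ ≤ _ := h3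
    _ ≤ n * (n * (η * C)) * 1 := by gcongr
    _ < ε := by
      have : 0 ≤ η * (n * n) := by positivity
      have : 0 ≤ η * (n * n) * C := by positivity
      nlinarith

open ContinuousLinearMap in
/-- Mollification. -/
lemma aux_moll {n : ℕ} (f : En n → ℝ) (hf : ContDiff ℝ 1 f) (hfc : HasCompactSupport f)
    (δ ε : ℝ) (hδ : 0 < δ) (hε : 0 < ε) :
    ∃ g : En n → ℝ, ContDiff ℝ (⊤ : ℕ∞) g ∧ tsupport g ⊆ Metric.cthickening δ (tsupport f) ∧
      ∀ x, ‖fderiv ℝ g x - fderiv ℝ f x‖ ≤ ε := by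
  have hc : Continuous (fderiv ℝ f) := hf.continuous_fderiv (by simp)
  have huc : UniformContinuous (fderiv ℝ f) :=
    (hfc.fderiv ℝ).uniformContinuous_of_continuous hc
  obtain ⟨r, hr, hru⟩ := Metric.uniformContinuous_iff.1 huc ε hε
  set s := min r δ with hs
  have hs0 : 0 < s := lt_min hr hδ
  let φ : ContDiffBump (0 : En n) := ⟨s / 2, s, by positivity, by linarith⟩
  have hφ : φ.rOut = s := rfl
  set g : En n → ℝ := convolution (φ.normed volume) f (lsmul ℝ ℝ) volume with hg
  have hder : ∀ x, fderiv ℝ g x =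
      convolution (φ.normed volume) (fderiv ℝ f) (lsmul ℝ ℝ) volume x := by
    intro x
    have h := hfc.hasFDerivAt_convolution_right (𝕜 := ℝ) (lsmul ℝ ℝ) (μ := volume)
      (f := φ.normed volume) (φ.continuous_normed.locallyIntegrable) hf x
    rw [h.fderiv]
    rfl
  refine ⟨g, ?_, ?_, ?_⟩
  · exact φ.hasCompactSupport_normed.contDiff_convolution_left _ φ.contDiff_normed
      hf.continuous.locallyIntegrable
  · refine closure_minimal ?_ Metric.isClosed_cthickening
    intro x hx
    by_contra hxn
    apply hx
    have hz : ∀ y ∈ Metric.ball x φ.rOut, f y = 0 := by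
      intro y hy
      by_contra hy0
      apply hxn
      refine Metric.mem_cthickening_of_dist_le x y δ _ (subset_tsupport f hy0) ?_
      rw [dist_comm]
      exact (Metric.mem_ball.1 hy).le.trans (by rw [hφ]; exact min_le_right _ _)
    have hx0 := hz x (Metric.mem_ball_self φ.rOut_pos)
    have := φ.dist_normed_convolution_le (μ := volume) (g := f) (x₀ := x) (ε := 0)
      hf.continuous.aestronglyMeasurable (fun y hy => by rw [hz y hy, hx0]; simp)
    rw [hx0] at this
    simpa using dist_le_zero.1 this
  · intro x
    rw [hder, ← dist_eq_norm]
    refine φ.dist_normed_convolution_le hc.aestronglyMeasurable (fun y hy => ?_)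
    exact (hru (lt_of_lt_of_le (Metric.mem_ball.1 hy) (min_le_left _ _))).le

lemma aux_C1 {n : ℕ} (Ω : Set (En n))
    (V : En n → En n) (hV : ContinuousOn V Ω)
    (hΩopen : IsOpen Ω) (μ : Measure (En n)) [IsProbabilityMeasure μ]
    (h : ∀ f : En n → ℝ, ContDiff ℝ (⊤ : ℕ∞) f → HasCompactSupport f → tsupport f ⊆ Ω →
      ∫ x in Ω, fderiv ℝ f x (V x) ∂μ = 0)
    (f : En n → ℝ) (hf : ContDiff ℝ 1 f) (hfc : HasCompactSupport f)
    (hfΩ : tsupport f ⊆ Ω) :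
    IntegrableOn (fun x => fderiv ℝ f x (V x)) Ω μ ∧ ∫ x in Ω, fderiv ℝ f x (V x) ∂μ = 0 := by
  have hint : ∀ f : En n → ℝ, ContDiff ℝ 1 f → HasCompactSupport f → tsupport f ⊆ Ω →
      IntegrableOn (fun x => fderiv ℝ f x (V x)) Ω μ := by
    intro f hf hfc hfΩ
    have hD : ContinuousOn (fun x => fderiv ℝ f x (V x)) Ω :=
      ((hf.continuous_fderiv (by simp)).continuousOn).clm_apply hV
    exact aux_int hD hΩopen (aux_bdd hD hfc hfΩ (fun x hx => by
      rw [aux_fderiv0 (subset_refl _) x hx]; rfl)) μ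
  refine ⟨hint f hf hfc hfΩ, ?_⟩
  obtain ⟨δ, hδ, hδΩ⟩ := IsCompact.exists_cthickening_subset_open hfc hΩopen hfΩ
  have hKc : IsCompact (Metric.cthickening δ (tsupport f)) := IsCompact.cthickening hfc
  obtain ⟨M, hM⟩ := hKc.exists_bound_of_continuousOn (hV.mono hδΩ)
  rw [← norm_le_zero_iff]
  refine le_of_forall_pos_le_add fun ε hε => ?_
  obtain ⟨g, hg, hgs, hgf⟩ := aux_moll f hf hfc δ (ε / (|M| + 1)) hδ (by positivity)
  have hgc : HasCompactSupport g := hKc.of_isClosed_subset (isClosed_tsupport g) hgs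
  have h0 := h g hg hgc (hgs.trans hδΩ)
  have e : ∫ x in Ω, fderiv ℝ f x (V x) ∂μ
      = ∫ x in Ω, (fderiv ℝ f x (V x) - fderiv ℝ g x (V x)) ∂μ := by
    rw [integral_sub (hint f hf hfc hfΩ)
      (hint g (hg.of_le (by simp)) hgc (hgs.trans hδΩ)), h0, sub_zero]
  have hb : ∀ x ∈ Ω, ‖fderiv ℝ f x (V x) - fderiv ℝ g x (V x)‖ ≤ ε := by
    intro x _
    by_cases hx : x ∈ Metric.cthickening δ (tsupport f)
    · rw [norm_sub_rev, ← ContinuousLinearMap.sub_apply]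
      calc _ ≤ ‖fderiv ℝ g x - fderiv ℝ f x‖ * ‖V x‖ := ContinuousLinearMap.le_opNorm _ _
        _ ≤ ε / (|M| + 1) * (|M| + 1) := by
          gcongr
          · exact hgf x
          · linarith [hM x hx, le_abs_self M]
        _ = ε := by field_simp
    · rw [aux_fderiv0 (Metric.self_subset_cthickening _) x hx, aux_fderiv0 hgs x hx]
      simpa using hε.le
  rw [e, zero_add]
  calc _ ≤ ε * μ.real Ω := norm_setIntegral_le_of_norm_le_const (measure_lt_top μ Ω) hb
    _ ≤ ε * 1 := by gcongr; exact measureReal_le_one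
    _ = ε := mul_one _

lemma aux_cut (a b : ℝ) : ∃ φ ψ : ℝ → ℝ, ContDiff ℝ 1 φ ∧ (∀ t, HasDerivAt φ (ψ t) t) ∧
    (∀ t, 0 ≤ ψ t) ∧ (∀ t, a < t → t < b → 0 < ψ t) ∧ (∀ t, t ≤ a → ψ t = 0) ∧
    (∀ t, b ≤ t → φ t = 0) := by
  set ψ : ℝ → ℝ := fun t => max 0 (t - a) * max 0 (b - t) with hψ
  have hc : Continuous ψ := by fun_prop
  have hd : ∀ t, HasDerivAt (fun t => ∫ s in b..t, ψ s) (ψ t) t := fun t =>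
    intervalIntegral.integral_hasDerivAt_right (hc.intervalIntegrable _ _)
      (hc.stronglyMeasurableAtFilter _ _) hc.continuousAt
  refine ⟨fun t => ∫ s in b..t, ψ s, ψ, ?_, hd, ?_, ?_, ?_, ?_⟩
  · rw [contDiff_one_iff_deriv]
    refine ⟨fun t => (hd t).differentiableAt, ?_⟩
    have : deriv (fun t => ∫ s in b..t, ψ s) = ψ := funext fun t => (hd t).deriv
    rw [this]; exact hc
  · intro t; exact mul_nonneg (le_max_left _ _) (le_max_left _ _)
  · intro t h1 h2
    exact mul_pos (lt_max_of_lt_right (by linarith)) (lt_max_of_lt_right (by linarith))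
  · intro t h
    simp only [hψ]
    rw [max_eq_left (by linarith), zero_mul]
  · intro t h
    have : ∫ s in b..t, ψ s = ∫ s in b..t, (0:ℝ) := by
      refine intervalIntegral.integral_congr fun s hs => ?_
      rw [uIcc_of_le h] at hs
      simp only [hψ]
      rw [max_eq_left (b := b - s) (by linarith [hs.1]), mul_zero]
    simpa using this

lemma aux_level {n : ℕ} (Ω : Set (En n))
    (V : En n → En n) (hV : ContinuousOn V Ω)
    (hΩopen : IsOpen Ω) (μ : Measure (En n)) [IsProbabilityMeasure μ]
    (h : ∀ f : En n → ℝ, ContDiff ℝ (⊤ : ℕ∞) f → HasCompactSupport f → tsupport f ⊆ Ω →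
      ∫ x in Ω, fderiv ℝ f x (V x) ∂μ = 0)
    (U : En n → ℝ) (hU : ContDiffOn ℝ 2 U Ω) (a b γ : ℝ) (hγ : 0 < γ)
    (hK : IsCompact {x ∈ Ω | U x ≤ b})
    (hL : ∀ x ∈ Ω, a < U x → fderiv ℝ U x (V x) ≤ -γ) :
    μ {x ∈ Ω | a < U x ∧ U x < b} = 0 := by
  obtain ⟨φ, ψ, hφ, hφd, hψ0, hψp, hψa, hφb⟩ := aux_cut a b
  classical
  set f : En n → ℝ := fun x => if x ∈ Ω then φ (U x) else 0 with hfdef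
  have hUat : ∀ x ∈ Ω, ContDiffAt ℝ 2 U x := fun x hx => hU.contDiffAt (hΩopen.mem_nhds hx)
  have hev : ∀ x ∈ Ω, f =ᶠ[𝓝 x] fun y => φ (U y) := by
    intro x hx
    filter_upwards [hΩopen.mem_nhds hx] with y hy
    simp [hfdef, hy]
  have hf0 : ∀ x, x ∉ {x ∈ Ω | U x ≤ b} → f x = 0 := by
    intro x hx
    by_cases hxΩ : x ∈ Ω
    · have : b < U x := by
        by_contra hh; exact hx ⟨hxΩ, not_lt.1 hh⟩
      simp [hfdef, hxΩ, hφb _ this.le]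
    · simp [hfdef, hxΩ]
  have hts : tsupport f ⊆ {x ∈ Ω | U x ≤ b} := by
    refine closure_minimal ?_ hK.isClosed
    intro x hx
    by_contra hh
    exact hx (hf0 x hh)
  have hfc : HasCompactSupport f := hK.of_isClosed_subset (isClosed_tsupport f) hts
  have hfΩ : tsupport f ⊆ Ω := fun x hx => (hts hx).1
  have hfC : ContDiff ℝ 1 f := by
    rw [contDiff_iff_contDiffAt]
    intro x
    by_cases hx : x ∈ Ω
    · refine ContDiffAt.congr_of_eventuallyEq ?_ (hev x hx)
      exact hφ.contDiffAt.comp x ((hUat x hx).of_le (by norm_num))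
    · have hx' : x ∉ tsupport f := fun h => hx (hfΩ h)
      exact (contDiffAt_const (c := (0:ℝ))).congr_of_eventuallyEq
        (notMem_tsupport_iff_eventuallyEq.1 hx')
  have hfd : ∀ x ∈ Ω, fderiv ℝ f x (V x) = ψ (U x) * fderiv ℝ U x (V x) := by
    intro x hx
    rw [(hev x hx).fderiv_eq]
    have h1 : HasFDerivAt U (fderiv ℝ U x) x :=
      ((hUat x hx).differentiableAt (by simp)).hasFDerivAt
    have h2 := (hφd (U x)).comp_hasFDerivAt x h1
    have h3 : fderiv ℝ (fun y => φ (U y)) x = ψ (U x) • fderiv ℝ U x := h2.fderiv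
    rw [h3]; rfl
  obtain ⟨hi, h0⟩ := aux_C1 Ω V hV hΩopen μ h f hfC hfc hfΩ
  have hneg : 0 ≤ᵐ[μ.restrict Ω] fun x => -fderiv ℝ f x (V x) := by
    refine (ae_restrict_iff' hΩopen.measurableSet).2 (Eventually.of_forall fun x hx => ?_)
    simp only [Pi.zero_apply]
    rw [hfd x hx]
    rcases le_or_gt (U x) a with hle | hgt
    · rw [hψa _ hle]; simp
    · have := mul_nonneg (hψ0 (U x)) (show 0 ≤ -fderiv ℝ U x (V x) by linarith [hL x hx hgt])
      linarith
  have hz := (setIntegral_eq_zero_iff_of_nonneg_ae hneg hi.neg).1 (by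
    rw [integral_neg, h0, neg_zero])
  have hz' := (ae_restrict_iff' hΩopen.measurableSet).1 hz
  refine measure_mono_null ?_ (ae_iff.1 hz')
  rintro x ⟨hx, hxa, hxb⟩
  simp only [mem_setOf_eq, Classical.not_imp]
  refine ⟨hx, ?_⟩
  have h1 := hψp _ hxa hxb
  have h2 := hL x hx hxa
  simp only [Pi.zero_apply]
  rw [hfd x hx]
  have : 0 < ψ (U x) * -fderiv ℝ U x (V x) := mul_pos h1 (by linarith)
  intro h3
  linarith

/-- Let `Ω ⊆ 𝒰` be a connected open set, `(A_k)` a null sequence of diffusion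
matrices admitting a uniform Lyapunov function `U` on `Ω` with essential lower bound `ρ_m`,
and let `μ_k` be stationary measures for `ℒ_{A_k}` on `Ω` with `μ_k → μ` weak*. Then
`supp μ ⊆ {x ∈ Ω : U(x) ≤ ρ_m}`. -/
theorem stmt9 {n : ℕ} (hn : 1 ≤ n) (𝒰 Ω : Set (En n))
    (h𝒰open : IsOpen 𝒰) (h𝒰conn : IsConnected 𝒰)
    (V : En n → En n) (hV : ContinuousOn V 𝒰)
    (hΩopen : IsOpen Ω) (hΩconn : IsConnected Ω) (hΩ𝒰 : Ω ⊆ 𝒰)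
    (A : ℕ → En n → Matrix (Fin n) (Fin n) ℝ) (hA : IsNullSeq 𝒰 A)
    (U : En n → ℝ) (ρm γ : ℝ) (hU : IsUniformLyap A V Ω U ρm γ)
    (μs : ℕ → Measure (En n)) (hμs : ∀ k, IsStationaryMeasure (A k) V Ω (μs k))
    (μ : Measure (En n)) (hμ : IsProbOn Ω μ) (hlim : WeakStarLimOn Ω μs μ) :
    measSupp μ ⊆ {x ∈ Ω | U x ≤ ρm} := by
  obtain ⟨hUC, ⟨hUc, hU0, hUlt, hUK⟩, hρ0, hρM, hγ, hLy⟩ := hU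
  haveI := hμ.1
  have hinv := aux_smooth 𝒰 Ω V hV hΩopen hΩ𝒰 A hA μs hμs μ hlim
  have hL : ∀ x ∈ Ω, ρm < U x → fderiv ℝ U x (V x) ≤ -γ := by
    intro x hx hxρ
    have hAt : ∀ i j, Tendsto (fun k => A k x i j) atTop (𝓝 0) := by
      intro i j
      rw [Metric.tendsto_atTop]
      intro ε hε
      obtain ⟨N, hN⟩ := hA.2.2 {x} (singleton_subset_iff.2 (hΩ𝒰 hx)) isCompact_singleton
        (ε / 2) (by positivity)
      refine ⟨N, fun k hk => ?_⟩
      rw [dist_zero_right]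
      have := hN k hk x rfl i j
      rw [Real.norm_eq_abs]
      linarith
    have ht : Tendsto (fun k => adjFP (A k) V U x) atTop (𝓝 (fderiv ℝ U x (V x))) := by
      have h1 : Tendsto (fun k => (∑ i, ∑ j, A k x i j * iteratedFDeriv ℝ 2 U x
          ![EuclideanSpace.single i (1 : ℝ), EuclideanSpace.single j (1 : ℝ)])) atTop
          (𝓝 (∑ i : Fin n, ∑ j : Fin n, 0 * iteratedFDeriv ℝ 2 U x
          ![EuclideanSpace.single i (1 : ℝ), EuclideanSpace.single j (1 : ℝ)])) :=
        tendsto_finsetSum _ fun i _ => tendsto_finsetSum _ fun j _ => (hAt i j).mul_const _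
      have h2 := h1.add_const (fderiv ℝ U x (V x))
      simpa [adjFP] using h2
    exact le_of_tendsto ht (Eventually.of_forall fun k => hLy k x hx hxρ)
  have hnull : μ {x ∈ Ω | ρm < U x} = 0 := by
    refine measure_null_of_locally_null _ fun x hx => ?_
    obtain ⟨b, hb1, hb2⟩ := EReal.lt_iff_exists_real_btwn.1 (hUlt x hx.1)
    have hb1' : U x < b := by exact_mod_cast hb1
    refine ⟨{x ∈ Ω | ρm < U x ∧ U x < b}, ?_, ?_⟩
    · refine mem_nhdsWithin_of_mem_nhds ?_
      have hcx := hUc.continuousAt (hΩopen.mem_nhds hx.1)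
      filter_upwards [hΩopen.mem_nhds hx.1, hcx.eventually (lt_mem_nhds hx.2),
        hcx.eventually (gt_mem_nhds hb1')] with y h1 h2 h3
      exact ⟨h1, h2, h3⟩
    · exact aux_level Ω V (hV.mono hΩ𝒰) hΩopen μ hinv U hUC ρm b γ hγ (hUK b hb2) hL
  intro x hx
  by_contra hxK
  have hpos := hx {x ∈ Ω | U x ≤ ρm}ᶜ (hUK ρm hρM).isClosed.isOpen_compl hxK
  refine hpos.ne' (measure_mono_null ?_ (measure_union_null hμ.2 hnull))
  intro y hy
  by_cases hyΩ : y ∈ Ω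
  · right
    refine ⟨hyΩ, ?_⟩
    by_contra hh
    exact hy ⟨hyΩ, not_lt.1 hh⟩
  · left; exact hyΩ


end
end

section
/- Let φ : [0,∞) × Ω → Ω be a positive semiflow generated by V on a Borel set Ω ⊆ 𝒰 whose closure is compact and contained in 𝒰, so that in particular φ(t, Ω) ⊆ Ω for all t ≥ 0. If μ is a positively invariant Borel probability measure of φ on Ω, i.e. μ(φ(t,·)⁻¹(B)) = μ(B) for every Borel B ⊆ Ω and every t ≥ 0, then the support of μ is contained in the ω-limit set ω(Ω) = ∩_{τ≥0} closure(∪_{t≥τ} φ(t, Ω)). -/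
open MeasureTheory Set Filter Topology

noncomputable section

/-- The positive semiflow generated by `V` on a positively invariant set `Ω`. -/
def IsSemiflowOn {n : ℕ} (V : En n → En n) (Ω : Set (En n)) (φ : ℝ → En n → En n) : Prop :=
  ContinuousOn (fun p : ℝ × En n => φ p.1 p.2) (Ici (0 : ℝ) ×ˢ Ω) ∧
  (∀ t : ℝ, 0 ≤ t → ∀ x ∈ Ω, φ t x ∈ Ω) ∧
  (∀ x ∈ Ω, φ 0 x = x) ∧
  (∀ t s : ℝ, 0 ≤ t → 0 ≤ s → ∀ x ∈ Ω, φ (t + s) x = φ t (φ s x)) ∧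
  (∀ x ∈ Ω, ∀ t : ℝ, 0 ≤ t →
    HasDerivWithinAt (fun τ => φ τ x) (V (φ t x)) (Ici 0) t)
/-- `μ` is a positively invariant measure of the semiflow `φ` on `Ω`:
`μ(φ(t,·)⁻¹(B)) = μ(B)` for every Borel `B ⊆ Ω` and every `t ≥ 0`. -/
def IsPosInvariantUnder {n : ℕ} (Ω : Set (En n)) (φ : ℝ → En n → En n)
    (μ : Measure (En n)) : Prop :=
  ∀ t : ℝ, 0 ≤ t → ∀ B : Set (En n), B ⊆ Ω → MeasurableSet B → μ (Ω ∩ φ t ⁻¹' B) = μ B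

/-- Let `φ` be a positive semiflow generated by `V` on a Borel set `Ω ⊆ 𝒰`
whose closure is compact and contained in `𝒰`. If `μ` is a positively invariant Borel
probability measure of `φ` on `Ω`, then the support of `μ` is contained in the ω-limit set
`ω(Ω) = ∩_{τ≥0} closure(∪_{t≥τ} φ(t,Ω))`. -/
theorem stmt19 {n : ℕ} (hn : 1 ≤ n) (𝒰 Ω : Set (En n))
    (h𝒰open : IsOpen 𝒰) (h𝒰conn : IsConnected 𝒰)
    (V : En n → En n) (hV : ContinuousOn V 𝒰)
    (hΩmeas : MeasurableSet Ω) (hΩcl : IsCompact (closure Ω)) (hΩ𝒰 : closure Ω ⊆ 𝒰)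
    (φ : ℝ → En n → En n) (hφ : IsSemiflowOn V Ω φ)
    (μ : Measure (En n)) (hμ : IsProbOn Ω μ) (hinv : IsPosInvariantUnder Ω φ μ) :
    measSupp μ ⊆ ⋂ (τ : ℝ) (_ : 0 ≤ τ), closure (⋃ (t : ℝ) (_ : τ ≤ t), φ t '' Ω) := by
  intro x hx
  simp only [mem_iInter]
  intro τ hτ
  by_contra hxC
  set C := closure (⋃ (t : ℝ) (_ : τ ≤ t), φ t '' Ω) with hC
  have hop : IsOpen Cᶜ := isClosed_closure.isOpen_compl
  have hpos : 0 < μ Cᶜ := hx _ hop hxC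
  have h1 := hinv τ hτ (Cᶜ ∩ Ω) inter_subset_right (hop.measurableSet.inter hΩmeas)
  have h2 : Ω ∩ φ τ ⁻¹' (Cᶜ ∩ Ω) = ∅ := by
    ext y
    simp only [mem_inter_iff, mem_preimage, mem_empty_iff_false, iff_false]
    rintro ⟨hy, hyC, -⟩
    exact hyC (subset_closure (mem_iUnion₂.2 ⟨τ, le_refl τ, mem_image_of_mem _ hy⟩))
  rw [h2, measure_empty] at h1
  have h3 : μ Cᶜ ≤ μ (Cᶜ ∩ Ω) + μ Ωᶜ := by
    refine (measure_mono ?_).trans (measure_union_le _ _)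
    intro y hy
    by_cases h : y ∈ Ω
    · exact Or.inl ⟨hy, h⟩
    · exact Or.inr h
  rw [← h1, hμ.2, add_zero] at h3
  exact absurd hpos (not_lt.2 h3)

end
end
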